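/- Let {⟨α_i,α_i'⟩}_{i∈I} be a full, interior disjoint, unlinked countable collection of segment pairings on [0,L], with induced relation R and chain semi-metric d^R. If 0 ≤ x < u < y < v ≤ L are points with d^R(x,y) = 0 and d^R(u,v) = 0, then d^R(x,u) = 0; consequently all four points x, u, y, v are at pairwise d^R-distance 0. (This is the statement that the equivalence relation induced by a plain paper-folding scheme is unlinked.) -/

import Mathlib

open Set

/-- A countable collection of segment pairings on the interval `[0, L]`:
the `i`-th pairing identifies the subinterval `[a i, b i]` with the subinterval
`[c i, d i]` (of the same positive length) in a length-preserving,
orientation-reversing way. -/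
structure SegPairings (L : ℝ) where
  ι : Type
  countable : Countable ι
  a : ι → ℝ
  b : ι → ℝ
  c : ι → ℝ
  d : ι → ℝ
  ha : ∀ i, 0 ≤ a i
  hbL : ∀ i, b i ≤ L
  hc : ∀ i, 0 ≤ c i
  hdL : ∀ i, d i ≤ L
  len_eq : ∀ i, b i - a i = d i - c i
  len_pos : ∀ i, 0 < b i - a i

namespace SegPairings

variable {L : ℝ} (P : SegPairings L)

/-- The open interiors of the segments of the pairings, indexed by `ι × Bool`. -/
def seg (p : P.ι × Bool) : Set ℝ :=
  if p.2 then Set.Ioo (P.c p.1) (P.d p.1) else Set.Ioo (P.a p.1) (P.b p.1)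

/-- The collection is interior disjoint: the open interiors of all of the
segments `α_i`, `α_i'` are pairwise disjoint. -/
def InteriorDisjoint : Prop :=
  Pairwise fun p q => Disjoint (P.seg p) (P.seg q)

/-- The collection is full: the total length of the pairings is `L`. -/
def Full : Prop := ∑' i, 2 * (P.b i - P.a i) = L

/-- `x` and `y` are paired by the `i`-th pairing (orientation-reversing
identification of `[a i, b i]` with `[c i, d i]`). -/
def PairedBy (i : P.ι) (x y : ℝ) : Prop :=
  ∃ t, 0 ≤ t ∧ t ≤ P.b i - P.a i ∧
    ((x = P.a i + t ∧ y = P.d i - t) ∨ (y = P.a i + t ∧ x = P.d i - t))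

/-- The reflexive symmetric relation induced by the collection of pairings. -/
def R (x y : ℝ) : Prop := x = y ∨ ∃ i, P.PairedBy i x y

/-- The set of lengths of `R`-chains from `x` to `y`. -/
def chainLengths (x y : ℝ) : Set ℝ :=
  {l | ∃ (k : ℕ) (p q : ℕ → ℝ), P.R x (p 0) ∧ (∀ i < k, P.R (q i) (p (i+1))) ∧
    P.R (q k) y ∧ l = ∑ i ∈ Finset.range (k+1), |p i - q i|}

/-- The chain semi-metric `d^R` induced by the collection of pairings. -/
noncomputable def dR (x y : ℝ) : ℝ := sInf (P.chainLengths x y)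

end SegPairings

/-- Two pairs of points `{x, x'}` and `{y, y'}` of `[0, L]` are unlinked: one of the
pairs is contained in the closure of a single connected component of the complement
(in `[0, L]`) of the other pair. -/
def UnlinkedPairs (x x' y y' : ℝ) : Prop :=
  (max y y' ≤ min x x' ∨ (min x x' ≤ min y y' ∧ max y y' ≤ max x x') ∨ max x x' ≤ min y y') ∨
  (max x x' ≤ min y y' ∨ (min y y' ≤ min x x' ∧ max x x' ≤ max y y') ∨ max y y' ≤ min x x')

/-- The collection of pairings is unlinked: points paired by two different pairings
always form unlinked pairs. -/
def SegPairings.Unlinked {L : ℝ} (P : SegPairings L) : Prop :=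
  ∀ i j, i ≠ j → ∀ x x' y y', P.PairedBy i x x' → P.PairedBy j y y' →
    UnlinkedPairs x x' y y'

namespace SegPairings

variable {L : ℝ} {P : SegPairings L}

variable (P) in
/-- The common length of the two segments of the `i`-th pairing. -/
def len (i : P.ι) : ℝ := P.b i - P.a i

variable (P) in
/-- The leftmost endpoint of the two segments of the `i`-th pairing. -/
noncomputable def lo (i : P.ι) : ℝ := min (P.a i) (P.c i)

variable (P) in
/-- The rightmost endpoint of the two segments of the `i`-th pairing. -/
noncomputable def hi (i : P.ι) : ℝ := max (P.b i) (P.d i)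

variable (P) in
/-- The total length of the pairs `{s, s'}` of points paired by the `i`-th pairing which
surround `z`, i.e. such that `z` lies strictly between `s` and `s'`. -/
noncomputable def depth (i : P.ι) (z : ℝ) : ℝ :=
  max 0 (min (P.len i) (min (z - P.lo i) (P.hi i - z)))

lemma len_pos' (i : P.ι) : 0 < P.len i := P.len_pos i

lemma InteriorDisjoint.le_or_le (h : P.InteriorDisjoint) (i : P.ι) :
    P.b i ≤ P.c i ∨ P.d i ≤ P.a i := by
  have h1 : Disjoint (Ioo (P.a i) (P.b i)) (Ioo (P.c i) (P.d i)) := by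
    simpa [seg] using h (show (i, false) ≠ (i, true) by simp)
  have := P.len_pos i
  have := P.len_eq i
  rw [Ioo_disjoint_Ioo] at h1
  rcases min_cases (P.b i) (P.d i) with h2 | h2 <;>
    rcases max_cases (P.a i) (P.c i) with h3 | h3 <;>
    first
      | (left; linarith)
      | (right; linarith)

/-- Either `lo, hi` are `a, d`, or they are `c, b`. -/
lemma InteriorDisjoint.lo_hi (h : P.InteriorDisjoint) (i : P.ι) :
    (P.lo i = P.a i ∧ P.hi i = P.d i ∧ P.b i ≤ P.c i) ∨
      (P.lo i = P.c i ∧ P.hi i = P.b i ∧ P.d i ≤ P.a i) := by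
  have := P.len_pos i
  have := P.len_eq i
  unfold lo hi
  rcases h.le_or_le i with h1 | h1
  · exact Or.inl ⟨min_eq_left (by linarith), max_eq_right (by linarith), h1⟩
  · exact Or.inr ⟨min_eq_right (by linarith), max_eq_left (by linarith), h1⟩

lemma InteriorDisjoint.two_mul_len_le (h : P.InteriorDisjoint) (i : P.ι) :
    2 * P.len i ≤ P.hi i - P.lo i := by
  have := P.len_eq i
  unfold len
  rcases h.lo_hi i with ⟨h1, h2, h3⟩ | ⟨h1, h2, h3⟩ <;> rw [h1, h2] <;> linarith

lemma InteriorDisjoint.pairedBy_iff (h : P.InteriorDisjoint) {i : P.ι} {x y : ℝ} :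
    P.PairedBy i x y ↔ ∃ t, 0 ≤ t ∧ t ≤ P.len i ∧
      ((x = P.lo i + t ∧ y = P.hi i - t) ∨ (y = P.lo i + t ∧ x = P.hi i - t)) := by
  have := P.len_eq i
  unfold PairedBy len
  rcases h.lo_hi i with ⟨h1, h2, -⟩ | ⟨h1, h2, -⟩ <;> rw [h1, h2]
  constructor
  all_goals
    rintro ⟨t, h3, h4, ⟨h5, h6⟩ | ⟨h5, h6⟩⟩
    · exact ⟨P.b i - P.a i - t, by linarith, by linarith,
        Or.inr ⟨by linarith, by linarith⟩⟩
    · exact ⟨P.b i - P.a i - t, by linarith, by linarith,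
        Or.inl ⟨by linarith, by linarith⟩⟩

lemma lt_depth_iff {i : P.ι} {z t : ℝ} (ht : 0 ≤ t) :
    t < P.depth i z ↔ t < P.len i ∧ P.lo i + t < z ∧ z < P.hi i - t := by
  unfold depth
  rw [lt_max_iff, lt_min_iff, lt_min_iff]
  constructor
  · rintro (h | ⟨h1, h2, h3⟩)
    · linarith
    · exact ⟨h1, by linarith, by linarith⟩
  · rintro ⟨h1, h2, h3⟩
    exact Or.inr ⟨h1, by linarith, by linarith⟩

lemma depth_nonneg (i : P.ι) (z : ℝ) : 0 ≤ P.depth i z := le_max_left _ _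

lemma abs_depth_sub_le (i : P.ι) (x y : ℝ) : |P.depth i x - P.depth i y| ≤ |x - y| := by
  unfold depth
  refine (abs_max_sub_max_le_max _ _ _ _).trans (max_le (by simp) ?_)
  refine (abs_min_sub_min_le_max _ _ _ _).trans (max_le (by simp) ?_)
  refine (abs_min_sub_min_le_max _ _ _ _).trans (max_le (by simp) ?_)
  rw [show P.hi i - x - (P.hi i - y) = -(x - y) by ring, abs_neg]

lemma min_depth_le_depth {i : P.ι} {x y z : ℝ} (hxy : x ≤ y) (hyz : y ≤ z) :
    min (P.depth i x) (P.depth i z) ≤ P.depth i y := by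
  refine le_of_forall_lt fun t ht => ?_
  rcases lt_or_ge t 0 with h0 | h0
  · exact h0.trans_le (depth_nonneg i y)
  · rw [lt_min_iff, lt_depth_iff h0, lt_depth_iff h0] at ht
    rw [lt_depth_iff h0]
    exact ⟨ht.1.1, by linarith [ht.1.2.1], by linarith [ht.2.2.2]⟩

lemma PairedBy.symm {i : P.ι} {x y : ℝ} (h : P.PairedBy i x y) : P.PairedBy i y x := by
  obtain ⟨t, h0, h1, h2⟩ := h
  exact ⟨t, h0, h1, h2.symm⟩

lemma R.symm {x y : ℝ} (h : P.R x y) : P.R y x := by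
  rcases h with h | ⟨i, h⟩
  · exact Or.inl h.symm
  · exact Or.inr ⟨i, h.symm⟩

lemma PairedBy.depth_self_le (h : P.InteriorDisjoint) {i : P.ι} {x y : ℝ}
    (hp : P.PairedBy i x y) : P.depth i x ≤ P.depth i y := by
  obtain ⟨t, h0, h1, h2⟩ := h.pairedBy_iff.1 hp
  have := h.two_mul_len_le i
  refine le_of_forall_lt fun s hs => ?_
  rcases lt_or_ge s 0 with hs0 | hs0
  · exact hs0.trans_le (depth_nonneg i y)
  · rw [lt_depth_iff hs0] at hs ⊢
    obtain ⟨h3, h4, h5⟩ := hs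
    rcases h2 with ⟨rfl, rfl⟩ | ⟨rfl, rfl⟩ <;>
      exact ⟨h3, by linarith, by linarith⟩

lemma PairedBy.depth_le (h : P.InteriorDisjoint) (hu : P.Unlinked) {i j : P.ι} {x y : ℝ}
    (hp : P.PairedBy j x y) : P.depth i y ≤ P.depth i x := by
  rcases eq_or_ne i j with rfl | hij
  · exact hp.symm.depth_self_le h
  by_contra! hlt
  obtain ⟨t, h1, h2⟩ := exists_between hlt
  have ht : 0 ≤ t := (depth_nonneg i x).trans h1.le
  obtain ⟨h3, h4, h5⟩ := (lt_depth_iff ht).1 h2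
  have h6 : x < P.lo i + t ∨ P.hi i - t < x := by
    by_contra! h7
    obtain ⟨s, hs, hst⟩ := exists_between h1
    have hs0 : 0 ≤ s := (depth_nonneg i x).trans hs.le
    exact lt_asymm hs ((lt_depth_iff hs0).2 ⟨by linarith, by linarith, by linarith⟩)
  have h7 := hu i j hij _ _ _ _
    (h.pairedBy_iff.2 ⟨t, ht, h3.le, Or.inl ⟨rfl, rfl⟩⟩) hp
  have h8 : P.lo i + t < P.hi i - t := h4.trans h5
  unfold UnlinkedPairs at h7
  rw [min_eq_left h8.le, max_eq_right h8.le] at h7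
  rcases le_total x y with hxy | hxy
  · rw [min_eq_left hxy, max_eq_right hxy] at h7
    rcases h6 with h6 | h6 <;>
      rcases h7 with (h7 | ⟨h7, h7'⟩ | h7) | (h7 | ⟨h7, h7'⟩ | h7) <;> linarith
  · rw [min_eq_right hxy, max_eq_left hxy] at h7
    rcases h6 with h6 | h6 <;>
      rcases h7 with (h7 | ⟨h7, h7'⟩ | h7) | (h7 | ⟨h7, h7'⟩ | h7) <;> linarith

lemma R.depth_eq (h : P.InteriorDisjoint) (hu : P.Unlinked) {x y : ℝ} (hR : P.R x y)
    (i : P.ι) : P.depth i x = P.depth i y := by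
  rcases hR with rfl | ⟨j, hj⟩
  · rfl
  · exact le_antisymm (hj.symm.depth_le h hu) (hj.depth_le h hu)

lemma self_abs_sub_mem_chainLengths (x y : ℝ) : |x - y| ∈ P.chainLengths x y :=
  ⟨0, fun _ => x, fun _ => y, Or.inl rfl, by simp, Or.inl rfl, by simp⟩

lemma R.zero_mem_chainLengths {x y : ℝ} (h : P.R x y) : 0 ∈ P.chainLengths x y :=
  ⟨0, fun _ => y, fun _ => y, h, by simp, Or.inl rfl, by simp⟩

lemma add_mem_chainLengths {x p w y l : ℝ} (h : P.R x p) (hl : l ∈ P.chainLengths w y) :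
    |p - w| + l ∈ P.chainLengths x y := by
  obtain ⟨k, p', q', h0, h1, h2, rfl⟩ := hl
  refine ⟨k + 1, fun n => Nat.casesOn n p p', fun n => Nat.casesOn n w q', h, ?_, h2, ?_⟩
  · rintro (_ | i) hi
    · exact h0
    · exact h1 i (by omega)
  · rw [Finset.sum_range_succ' _ (k + 1)]
    exact add_comm _ _

lemma mem_chainLengths_comm {x y l : ℝ} (hl : l ∈ P.chainLengths x y) :
    l ∈ P.chainLengths y x := by
  obtain ⟨k, p, q, h0, h1, h2, rfl⟩ := hl
  refine ⟨k, fun n => q (k - n), fun n => p (k - n), by simpa using h2.symm, ?_,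
    by simpa using h0.symm, ?_⟩
  · intro i hi
    have := (h1 (k - (i + 1)) (by omega)).symm
    rwa [show k - (i + 1) + 1 = k - i by omega] at this
  · rw [← Finset.sum_range_reflect]
    refine Finset.sum_congr rfl fun i _ => ?_
    rw [abs_sub_comm, show k + 1 - 1 - i = k - i by omega]

lemma dR_comm (x y : ℝ) : P.dR x y = P.dR y x :=
  congrArg sInf (Set.ext fun _ => ⟨mem_chainLengths_comm, mem_chainLengths_comm⟩)

lemma nonneg_of_mem_chainLengths {x y l : ℝ} (hl : l ∈ P.chainLengths x y) : 0 ≤ l := by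
  obtain ⟨k, p, q, -, -, -, rfl⟩ := hl
  exact Finset.sum_nonneg fun _ _ => abs_nonneg _

lemma dR_eq_zero {x y : ℝ} (h : ∀ ε > 0, ∃ l ∈ P.chainLengths x y, l ≤ ε) :
    P.dR x y = 0 := by
  refine le_antisymm (le_of_forall_pos_le_add fun ε hε => ?_)
    (Real.sInf_nonneg fun _ => nonneg_of_mem_chainLengths)
  obtain ⟨l, hl, hle⟩ := h ε hε
  rw [zero_add]
  exact (csInf_le ⟨0, fun _ => nonneg_of_mem_chainLengths⟩ hl).trans hle

lemma R.dR_eq_zero {x y : ℝ} (h : P.R x y) : P.dR x y = 0 :=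
  SegPairings.dR_eq_zero fun _ hε => ⟨0, h.zero_mem_chainLengths, hε.le⟩

lemma abs_depth_sub_le_of_mem_chainLengths (h : P.InteriorDisjoint) (hu : P.Unlinked)
    {x y l : ℝ} (hl : l ∈ P.chainLengths x y) (i : P.ι) :
    |P.depth i x - P.depth i y| ≤ l := by
  obtain ⟨k, p, q, h0, h1, h2, rfl⟩ := hl
  rw [h0.depth_eq h hu]
  induction k generalizing y with
  | zero =>
    rw [← h2.depth_eq h hu]
    simpa using abs_depth_sub_le i (p 0) (q 0)
  | succ k ih =>
    have h3 := ih (fun j hj => h1 j (by omega)) (h1 k (by omega))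
    rw [Finset.sum_range_succ, ← h2.depth_eq h hu]
    exact (abs_sub_le _ (P.depth i (p (k + 1))) _).trans
      (add_le_add h3 (abs_depth_sub_le i _ _))

lemma depth_eq_of_dR_eq_zero (h : P.InteriorDisjoint) (hu : P.Unlinked) {x y : ℝ}
    (hxy : P.dR x y = 0) (i : P.ι) : P.depth i x = P.depth i y := by
  have h1 : |P.depth i x - P.depth i y| ≤ P.dR x y :=
    le_csInf ⟨_, self_abs_sub_mem_chainLengths x y⟩
      fun _ hl => abs_depth_sub_le_of_mem_chainLengths h hu hl i
  rw [hxy] at h1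
  exact sub_eq_zero.1 (abs_nonpos_iff.1 h1)

open MeasureTheory in
lemma InteriorDisjoint.sum_two_mul_len_le (h : P.InteriorDisjoint) (F : Finset P.ι)
    {S : Set ℝ} (hS : volume S ≠ ⊤) (hF : ∀ i ∈ F, ∀ s, P.seg (i, s) ⊆ S) :
    ∑ i ∈ F, 2 * P.len i ≤ volume.real S := by
  have hm : ∀ p ∈ F ×ˢ (Finset.univ : Finset Bool), MeasurableSet (P.seg p) := by
    intro p _
    unfold seg
    split_ifs <;> exact measurableSet_Ioo
  have h1 : volume.real (⋃ p ∈ F ×ˢ (Finset.univ : Finset Bool), P.seg p) ≤ volume.real S := by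
    refine measureReal_mono ?_ hS
    simp only [iUnion_subset_iff]
    exact fun p hp => hF p.1 (Finset.mem_product.1 hp).1 p.2
  refine le_trans (le_of_eq ?_) h1
  rw [measureReal_biUnion_finset (fun p _ q _ hpq => h hpq) hm ?_]
  · rw [Finset.sum_product]
    refine Finset.sum_congr rfl fun i _ => ?_
    have := P.len_pos i
    have := P.len_eq i
    simp only [Fintype.sum_bool, seg, if_true, Bool.false_eq_true, if_false,
      Real.volume_real_Ioo_of_le (show P.a i ≤ P.b i by linarith),
      Real.volume_real_Ioo_of_le (show P.c i ≤ P.d i by linarith), len]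
    linarith
  · intro p hp
    exact measure_ne_top_of_subset (hF p.1 (Finset.mem_product.1 hp).1 p.2) hS

lemma seg_subset_Icc (i : P.ι) (s : Bool) : P.seg (i, s) ⊆ Icc (P.lo i) (P.hi i) := by
  unfold seg lo hi
  cases s
  · exact Ioo_subset_Icc_self.trans (Icc_subset_Icc (min_le_left _ _) (le_max_left _ _))
  · exact Ioo_subset_Icc_self.trans (Icc_subset_Icc (min_le_right _ _) (le_max_right _ _))

lemma InteriorDisjoint.seg_subset_union (h : P.InteriorDisjoint) (i : P.ι) (s : Bool) :
    P.seg (i, s) ⊆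
      Icc (P.lo i) (P.lo i + P.len i) ∪ Icc (P.hi i - P.len i) (P.hi i) := by
  intro z hz
  have := P.len_eq i
  unfold len
  rcases h.lo_hi i with ⟨h1, h2, -⟩ | ⟨h1, h2, -⟩ <;> rw [h1, h2] <;>
    cases s <;> simp only [seg, if_true, Bool.false_eq_true, if_false] at hz <;>
    first
      | exact Or.inl ⟨by linarith [hz.1], by linarith [hz.2]⟩
      | exact Or.inr ⟨by linarith [hz.1], by linarith [hz.2]⟩

/-- Jumping across the pairings of a finite family contained in `[x, y]` yields a chain
from `x` to `y` which avoids all of the segments of the family. -/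
lemma exists_mem_chainLengths_le (h : P.InteriorDisjoint) (hu : P.Unlinked)
    (F : Finset P.ι) {x y : ℝ} (hxy : x ≤ y)
    (hF : ∀ i ∈ F, x ≤ P.lo i ∧ P.hi i ≤ y) :
    ∃ l ∈ P.chainLengths x y, l ≤ y - x - ∑ i ∈ F, 2 * P.len i := by
  induction F using Finset.strongInduction generalizing x with
  | H F ih =>
  rcases F.eq_empty_or_nonempty with rfl | hne
  · refine ⟨_, self_abs_sub_mem_chainLengths x y, ?_⟩
    rw [abs_sub_comm, abs_of_nonneg (by linarith)]
    simp
  obtain ⟨i, hi, hmin⟩ := F.exists_min_image P.lo hne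
  have hpos := len_pos' i
  have hlen := h.two_mul_len_le i
  have hR : P.R (P.lo i) (P.hi i) :=
    Or.inr ⟨i, h.pairedBy_iff.2 ⟨0, le_rfl, hpos.le, Or.inl ⟨by simp, by simp⟩⟩⟩
  have hcut : ∀ j, P.lo i ≤ P.lo j → P.hi i ≤ P.lo j ∨ P.hi j ≤ P.hi i := by
    intro j hj
    by_contra! hlt
    have h1 : 0 < P.depth j (P.hi i) :=
      (lt_depth_iff le_rfl).2 ⟨len_pos' j, by linarith, by linarith⟩
    rw [← hR.depth_eq h hu, lt_depth_iff le_rfl] at h1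
    linarith [h1.2.1]
  obtain ⟨l, hl, hle⟩ := ih (F.filter fun j => P.hi i ≤ P.lo j)
    (Finset.filter_ssubset.2 ⟨i, hi, by linarith⟩) (hF i hi).2
    (fun j hj => ⟨(Finset.mem_filter.1 hj).2, (hF j (Finset.mem_filter.1 hj).1).2⟩)
  have h2 : ∑ j ∈ F.filter (fun j => ¬ P.hi i ≤ P.lo j), 2 * P.len j ≤
      P.hi i - P.lo i := by
    have h3 := h.sum_two_mul_len_le (F.filter (fun j => ¬ P.hi i ≤ P.lo j))
      (S := Icc (P.lo i) (P.hi i)) (by simp) (fun j hj s =>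
        (seg_subset_Icc j s).trans (Icc_subset_Icc (hmin j (Finset.mem_filter.1 hj).1)
          ((hcut j (hmin j (Finset.mem_filter.1 hj).1)).resolve_left
            (Finset.mem_filter.1 hj).2)))
    rwa [Real.volume_real_Icc_of_le (by linarith)] at h3
  refine ⟨_, add_mem_chainLengths (Or.inl rfl) (add_mem_chainLengths hR hl), ?_⟩
  rw [← Finset.sum_filter_add_sum_filter_not F (fun j => P.hi i ≤ P.lo j), sub_self, abs_zero,
    abs_sub_comm, abs_of_nonneg (by linarith [(hF i hi).1])]
  linarith

/-- If `x < y` have the same depth with respect to the `i`-th pairing and are not paired by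
it, then the two segments of this pairing lie inside `[x, y]` or outside `(x, y)`. -/
lemma eq_depth_cases (h : P.InteriorDisjoint) {i : P.ι} {x y : ℝ} (hxy : x < y)
    (hd : P.depth i x = P.depth i y) (hR : ¬ P.PairedBy i x y) :
    (x ≤ P.lo i ∧ P.hi i ≤ y) ∨ y ≤ P.lo i ∨ P.hi i ≤ x ∨
      (P.lo i + P.len i ≤ x ∧ y ≤ P.hi i - P.len i) := by
  have hlen := h.two_mul_len_le i
  have hpos := len_pos' i
  by_contra! hcon
  obtain ⟨h1, h2, h3, h4⟩ := hcon
  have key : ∀ t, 0 ≤ t → t < P.len i →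
      ((P.lo i + t < x ∧ x < P.hi i - t) ↔ (P.lo i + t < y ∧ y < P.hi i - t)) := by
    intro t ht htl
    have h5 := lt_depth_iff (i := i) (z := x) ht
    rw [hd, lt_depth_iff ht] at h5
    simpa [htl] using h5.symm
  have hx : P.lo i < x := by
    by_contra! hx
    have := ((key 0 le_rfl hpos).2 ⟨by linarith, by linarith [h1 hx]⟩).1
    linarith
  have hy : y < P.hi i := by
    have := ((key 0 le_rfl hpos).1 ⟨by linarith, by linarith⟩).2
    linarith
  refine hR (h.pairedBy_iff.2 ?_)
  by_cases hxl : x < P.lo i + P.len i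
  · refine ⟨x - P.lo i, by linarith, by linarith, Or.inl ⟨by ring, ?_⟩⟩
    refine le_antisymm ?_ ?_
    · by_contra! hlt
      obtain ⟨t, ht1, ht2⟩ := exists_between (show max 0 (P.hi i - y) < x - P.lo i from
        max_lt (by linarith) (by linarith))
      have := ((key t (by linarith [le_max_left 0 (P.hi i - y)]) (by linarith)).1
        ⟨by linarith, by linarith⟩).2
      linarith [le_max_right 0 (P.hi i - y)]
    · by_contra! hlt
      have := ((key (x - P.lo i) (by linarith) (by linarith)).2
        ⟨by linarith, by linarith⟩).1
      linarith
  · have hyl := h4 (not_lt.1 hxl)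
    have := ((key (P.hi i - y) (by linarith) (by linarith)).1
      ⟨by linarith, by linarith⟩).2
    linarith

lemma Full.hasSum (hL : 0 < L) (hfull : P.Full) : HasSum (fun i => 2 * P.len i) L := by
  have hs : Summable fun i => 2 * P.len i := by
    by_contra hs
    have : (0 : ℝ) = L := (tsum_eq_zero_of_not_summable hs).symm.trans hfull
    linarith
  exact hs.hasSum_iff.2 hfull

lemma dR_eq_zero_of_depth_eq_of_lt (hL : 0 < L) (hfull : P.Full) (h : P.InteriorDisjoint)
    (hu : P.Unlinked) {x y : ℝ} (hx : 0 ≤ x) (hxy : x < y) (hy : y ≤ L)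
    (hd : ∀ i, P.depth i x = P.depth i y) : P.dR x y = 0 := by
  by_cases hR : P.R x y
  · exact hR.dR_eq_zero
  refine dR_eq_zero fun ε hε => ?_
  obtain ⟨G, hG⟩ :=
    ((hfull.hasSum hL).eventually (lt_mem_nhds (show L - ε < L by linarith))).exists
  classical
  obtain ⟨l, hl, hle⟩ := exists_mem_chainLengths_le h hu
    (G.filter fun i => x ≤ P.lo i ∧ P.hi i ≤ y) hxy.le (fun i hi => (Finset.mem_filter.1 hi).2)
  refine ⟨l, hl, hle.trans ?_⟩
  have hout := h.sum_two_mul_len_le (G.filter fun i => ¬ (x ≤ P.lo i ∧ P.hi i ≤ y))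
    (S := Icc 0 x ∪ Icc y L) (MeasureTheory.measure_union_ne_top (by simp) (by simp)) ?_
  · have h1 := hout.trans (MeasureTheory.measureReal_union_le _ _)
    rw [Real.volume_real_Icc_of_le hx, Real.volume_real_Icc_of_le hy] at h1
    rw [← Finset.sum_filter_add_sum_filter_not G (fun i => x ≤ P.lo i ∧ P.hi i ≤ y)] at hG
    linarith
  · intro i hi s
    have hlo : 0 ≤ P.lo i := le_min (P.ha i) (P.hc i)
    have hhi : P.hi i ≤ L := max_le (P.hbL i) (P.hdL i)
    rcases (eq_depth_cases h hxy (hd i) fun hp => hR (Or.inr ⟨i, hp⟩)).resolve_left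
      (Finset.mem_filter.1 hi).2 with h1 | h1 | ⟨h1, h2⟩
    · exact ((seg_subset_Icc i s).trans (Icc_subset_Icc h1 hhi)).trans subset_union_right
    · exact ((seg_subset_Icc i s).trans (Icc_subset_Icc hlo h1)).trans subset_union_left
    · exact (h.seg_subset_union i s).trans
        (union_subset_union (Icc_subset_Icc hlo h1) (Icc_subset_Icc h2 hhi))

/-- Points of `[0, L]` with the same depths are at chain distance `0`. -/
lemma dR_eq_zero_of_depth_eq (hL : 0 < L) (hfull : P.Full) (h : P.InteriorDisjoint)
    (hu : P.Unlinked) {x y : ℝ} (hx : x ∈ Icc 0 L) (hy : y ∈ Icc 0 L)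
    (hd : ∀ i, P.depth i x = P.depth i y) : P.dR x y = 0 := by
  rcases lt_trichotomy x y with hxy | hxy | hxy
  · exact dR_eq_zero_of_depth_eq_of_lt hL hfull h hu hx.1 hxy hy.2 hd
  · exact R.dR_eq_zero (Or.inl hxy)
  · rw [dR_comm]
    exact dR_eq_zero_of_depth_eq_of_lt hL hfull h hu hy.1 hxy hx.2 fun i => (hd i).symm

end SegPairings

/-- The equivalence relation induced by a plain paper-folding scheme is unlinked:
if `x < u < y < v` in `[0, L]` with `d^R(x,y) = 0` and `d^R(u,v) = 0`, then
`d^R(x,u) = 0`, and consequently all four points are at pairwise `d^R`-distance `0`. -/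
theorem stmt3 {L : ℝ} (hL : 0 < L) (P : SegPairings L)
    (hfull : P.Full) (hdisj : P.InteriorDisjoint) (hunl : P.Unlinked)
    (x u y v : ℝ) (hx : 0 ≤ x) (hxu : x < u) (huy : u < y) (hyv : y < v) (hvL : v ≤ L)
    (hxy : P.dR x y = 0) (huv : P.dR u v = 0) :
    P.dR x u = 0 ∧
      ∀ p ∈ ({x, u, y, v} : Set ℝ), ∀ q ∈ ({x, u, y, v} : Set ℝ), P.dR p q = 0 := by
  have hdxy := SegPairings.depth_eq_of_dR_eq_zero hdisj hunl hxy
  have hduv := SegPairings.depth_eq_of_dR_eq_zero hdisj hunl huv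
  have hdxu : ∀ i, P.depth i x = P.depth i u := by
    intro i
    have h1 := SegPairings.min_depth_le_depth (i := i) hxu.le huy.le
    have h2 := SegPairings.min_depth_le_depth (i := i) huy.le hyv.le
    rw [← hdxy, min_self] at h1
    rw [← hduv, min_self, ← hdxy] at h2
    exact le_antisymm h1 h2
  have key : ∀ p ∈ ({x, u, y, v} : Set ℝ),
      p ∈ Icc 0 L ∧ ∀ i, P.depth i p = P.depth i x := by
    rintro p (rfl | rfl | rfl | rfl)
    · exact ⟨⟨by linarith, by linarith⟩, fun _ => rfl⟩
    · exact ⟨⟨by linarith, by linarith⟩, fun i => (hdxu i).symm⟩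
    · exact ⟨⟨by linarith, by linarith⟩, fun i => (hdxy i).symm⟩
    · exact ⟨⟨by linarith, by linarith⟩, fun i => by rw [hdxu, hduv]⟩
  have main : ∀ p ∈ ({x, u, y, v} : Set ℝ), ∀ q ∈ ({x, u, y, v} : Set ℝ), P.dR p q = 0 :=
    fun p hp q hq => SegPairings.dR_eq_zero_of_depth_eq hL hfull hdisj hunl
      (key p hp).1 (key q hq).1 fun i => ((key p hp).2 i).trans ((key q hq).2 i).symm
  exact ⟨main x (by simp) u (by simp), main⟩
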